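/- Let λ be a real number, let r, α be positive integers, and let n be an integer with n ≥ r + α. Then C(r+α, r) · {n brace r+α}_λ = ∑_{k=r}^{n} C(n,k) · {k brace r}_λ · {n−k brace α}_λ. -/

import Mathlib

/-- The degenerate falling factorial `(x)_{n,λ} = x(x-λ)⋯(x-(n-1)λ)`. -/
noncomputable def dff (lam x : ℝ) (n : ℕ) : ℝ := ∏ i ∈ Finset.range n, (x - i * lam)

/-- The degenerate Stirling number of the second kind
`{n brace k}_λ = (1/k!) ∑_{j=0}^{k} C(k,j) (-1)^{k-j} (j)_{n,λ}`. -/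
noncomputable def dstirling (lam : ℝ) (n k : ℕ) : ℝ :=
  (1 / (k.factorial : ℝ)) *
    ∑ j ∈ Finset.range (k + 1), (k.choose j : ℝ) * (-1) ^ (k - j) * dff lam (j : ℝ) n

/-- The generalized binomial coefficient `C(x,m) = x(x-1)⋯(x-m+1)/m!` with real upper argument. -/
noncomputable def gchoose (x : ℝ) (m : ℕ) : ℝ := (∏ i ∈ Finset.range m, (x - i)) / m.factorial

/-- Generalized binomial coefficient with integer lower argument; zero when the lower
argument is negative. -/
noncomputable def gchooseZ (x : ℝ) (m : ℤ) : ℝ := if 0 ≤ m then gchoose x m.toNat else 0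

theorem dff_succ (lam x : ℝ) (n : ℕ) : dff lam x (n + 1) = dff lam x n * (x - n * lam) :=
  Finset.prod_range_succ _ _

/-- Vandermonde's identity for degenerate falling factorials. -/
theorem dff_add (lam x y : ℝ) (n : ℕ) :
    dff lam (x + y) n = ∑ p ∈ Finset.HasAntidiagonal.antidiagonal n,
      (n.choose p.1 : ℝ) * (dff lam x p.1 * dff lam y p.2) := by
  induction n with
  | zero => simp [dff]
  | succ n ih =>
    rw [Finset.sum_antidiagonal_choose_succ_mul (fun i j => dff lam x i * dff lam y j),
      dff_succ, ih, Finset.sum_mul, ← Finset.sum_add_distrib]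
    refine Finset.sum_congr rfl fun p hp => ?_
    have hn := Finset.HasAntidiagonal.mem_antidiagonal.mp hp
    have hc : n.choose p.2 = n.choose p.1 := Nat.choose_symm_of_eq_add (by omega)
    rw [hc, dff_succ, dff_succ, ← hn]
    push_cast
    ring

/-- The exponential generating function of `dff lam x`, that is `(1 + λ t)^(x / λ)`. -/
noncomputable def degenerateExp (lam x : ℝ) : PowerSeries ℝ :=
  PowerSeries.mk fun n => dff lam x n / n.factorial

theorem degenerateExp_zero (lam : ℝ) : degenerateExp lam 0 = 1 := by
  ext n
  cases n with
  | zero => simp [degenerateExp, dff]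
  | succ n => simp [degenerateExp, dff, Finset.prod_range_succ', PowerSeries.coeff_one]

theorem degenerateExp_add (lam x y : ℝ) :
    degenerateExp lam (x + y) = degenerateExp lam x * degenerateExp lam y := by
  ext n
  simp only [degenerateExp, PowerSeries.coeff_mul, PowerSeries.coeff_mk, dff_add, Finset.sum_div]
  refine Finset.sum_congr rfl fun p hp => ?_
  rw [← Finset.HasAntidiagonal.mem_antidiagonal.mp hp, Nat.cast_add_choose]
  have := Nat.factorial_ne_zero (p.1 + p.2)
  field_simp

theorem degenerateExp_natCast (lam : ℝ) (j : ℕ) :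
    degenerateExp lam j = degenerateExp lam 1 ^ j := by
  induction j with
  | zero => simp [degenerateExp_zero]
  | succ j ih => rw [Nat.cast_succ, degenerateExp_add, ih, pow_succ]

theorem dstirling_eq_coeff (lam : ℝ) (n k : ℕ) :
    dstirling lam n k =
      n.factorial / k.factorial * PowerSeries.coeff n ((degenerateExp lam 1 - 1) ^ k) := by
  rw [sub_eq_add_neg, add_pow, map_sum, dstirling, Finset.mul_sum, Finset.mul_sum]
  refine Finset.sum_congr rfl fun j _ => ?_
  have hC : degenerateExp lam 1 ^ j * (-1) ^ (k - j) * (k.choose j : PowerSeries ℝ) =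
      PowerSeries.C ((-1) ^ (k - j) * (k.choose j : ℝ)) * degenerateExp lam j := by
    rw [degenerateExp_natCast]
    simp only [map_mul, map_pow, map_neg, map_one, map_natCast]
    ring
  rw [hC, PowerSeries.coeff_C_mul, degenerateExp, PowerSeries.coeff_mk]
  have := Nat.factorial_ne_zero n
  field_simp

theorem dstirling_eq_zero_of_lt (lam : ℝ) {n k : ℕ} (h : n < k) : dstirling lam n k = 0 := by
  have hX : PowerSeries.X ∣ degenerateExp lam 1 - 1 := by
    rw [PowerSeries.X_dvd_iff]
    simp [degenerateExp, dff]
  rw [dstirling_eq_coeff, PowerSeries.X_pow_dvd_iff.mp (pow_dvd_pow_of_dvd hX k) n h, mul_zero]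

theorem dstirling_convolution (lam : ℝ) (r α : ℕ) (hr : 0 < r) (hα : 0 < α) (n : ℕ)
    (h : r + α ≤ n) :
    ((r + α).choose r : ℝ) * dstirling lam n (r + α) =
      ∑ k ∈ Finset.Icc r n, (n.choose k : ℝ) * dstirling lam k r * dstirling lam (n - k) α := by
  have hsub : Finset.Icc r n ⊆ Finset.range (n + 1) := fun k hk => by
    simp only [Finset.mem_Icc, Finset.mem_range] at *
    omega
  rw [Finset.sum_subset hsub fun k hk hk' => by
      have hkr : k < r := by
        simp only [Finset.mem_Icc, Finset.mem_range] at *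
        omega
      rw [dstirling_eq_zero_of_lt lam hkr, mul_zero, zero_mul],
    ← Finset.Nat.sum_antidiagonal_eq_sum_range_succ
      (fun i j => (n.choose i : ℝ) * dstirling lam i r * dstirling lam j α),
    dstirling_eq_coeff, pow_add, PowerSeries.coeff_mul, Finset.mul_sum, Finset.mul_sum]
  refine Finset.sum_congr rfl fun p hp => ?_
  rw [dstirling_eq_coeff, dstirling_eq_coeff, ← Finset.HasAntidiagonal.mem_antidiagonal.mp hp,
    Nat.cast_add_choose, Nat.cast_add_choose]
  have := Nat.factorial_ne_zero (r + α)
  field_simp
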